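/- arXiv:2308.07438 — 9 statements merged into one kernel-verified Lean document; each statement's English description precedes it below -/
import Mathlib

section
/- If f : [0,1] → ℝ is quasi-continuous, then the set C_f of points x ∈ [0,1] at which f is continuous relative to [0,1] (i.e. ContinuousWithinAt f [0,1] x) is an intersection of countably many dense, relatively open subsets of [0,1]; in particular C_f is dense in [0,1] and nonempty. -/
open Set

/-- `f` is quasi-continuous at `x₀` within `I`: for every `ε > 0` and every set
`U ⊆ I` containing `x₀` that is open in the subspace topology of `I`, there is a
nonempty set `G ⊆ U`, open in the subspace topology of `I`, on which `f` is
`ε`-close to `f x₀`. -/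
def QuasiContinuousWithinAt (f : ℝ → ℝ) (I : Set ℝ) (x₀ : ℝ) : Prop :=
  ∀ ε > (0 : ℝ), ∀ U : Set ℝ, U ⊆ I → x₀ ∈ U →
    IsOpen ((Subtype.val) ⁻¹' U : Set I) →
    ∃ G : Set ℝ, G ⊆ U ∧ G.Nonempty ∧ IsOpen ((Subtype.val) ⁻¹' G : Set I) ∧
      ∀ x ∈ G, |f x₀ - f x| < ε

def QuasiContinuousOn (f : ℝ → ℝ) (I : Set ℝ) : Prop :=
  ∀ x₀ ∈ I, QuasiContinuousWithinAt f I x₀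

section OscillationLT

variable {X Y : Type*} [TopologicalSpace X] [PseudoMetricSpace Y]

/-- The union of all open sets on which any two values of `g` are less than `ε` apart. -/
def oscillationLT (g : X → Y) (ε : ℝ) : Set X :=
  {x | ∃ V : Set X, IsOpen V ∧ x ∈ V ∧ ∀ y ∈ V, ∀ z ∈ V, dist (g y) (g z) < ε}

theorem isOpen_oscillationLT (g : X → Y) (ε : ℝ) : IsOpen (oscillationLT g ε) :=
  isOpen_iff_forall_mem_open.2 fun _ ⟨V, hV, hx, h⟩ =>
    ⟨V, fun _ hy => ⟨V, hV, hy, h⟩, hV, hx⟩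

theorem continuousAt_iff_forall_mem_oscillationLT (g : X → Y) (x : X) :
    ContinuousAt g x ↔ ∀ n : ℕ, x ∈ oscillationLT g (1 / (n + 1)) := by
  rw [Metric.continuousAt_iff']
  constructor
  · intro h n
    obtain ⟨V, hV, hVo, hx⟩ :=
      eventually_nhds_iff.1 (h _ (half_pos (Nat.one_div_pos_of_nat (n := n))))
    refine ⟨V, hVo, hx, fun y hy z hz => ?_⟩
    linarith [dist_triangle_right (g y) (g z) (g x), hV y hy, hV z hz]
  · intro h ε hε
    obtain ⟨n, hn⟩ := exists_nat_one_div_lt hε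
    obtain ⟨V, hVo, hx, hV⟩ := h n
    filter_upwards [hVo.mem_nhds hx] with y hy
    exact (hV y hy x hx).trans hn

theorem dense_oscillationLT {g : X → Y} {ε : ℝ}
    (hg : ∀ x, ∀ U : Set X, IsOpen U → x ∈ U →
      ∃ G ⊆ U, G.Nonempty ∧ IsOpen G ∧ ∀ y ∈ G, dist (g x) (g y) < ε / 2) :
    Dense (oscillationLT g ε) := by
  rw [dense_iff_inter_open]
  rintro U hU ⟨x, hx⟩
  obtain ⟨G, hGU, ⟨y, hy⟩, hGo, hG⟩ := hg x U hU hx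
  refine ⟨y, hGU hy, G, hGo, hy, fun a ha b hb => ?_⟩
  linarith [dist_triangle_left (g a) (g b) (g x), hG a ha, hG b hb]

end OscillationLT

theorem QuasiContinuousOn.exists_open_dist_lt {f : ℝ → ℝ} {I : Set ℝ}
    (hf : QuasiContinuousOn f I) {ε : ℝ} (hε : 0 < ε) (x : I) (U : Set I) (hU : IsOpen U)
    (hx : x ∈ U) :
    ∃ G ⊆ U, G.Nonempty ∧ IsOpen G ∧ ∀ y ∈ G, dist (I.domRestrict f x) (I.domRestrict f y) < ε := by
  obtain ⟨G, hGU, ⟨y, hy⟩, hGo, hG⟩ := hf x x.2 ε hε (Subtype.val '' U)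
    (Subtype.coe_image_subset I U) (mem_image_of_mem _ hx)
    (by rwa [preimage_image_eq _ Subtype.val_injective])
  refine ⟨Subtype.val ⁻¹' G, fun z hz => ?_, ?_, hGo, fun z hz => hG z hz⟩
  · exact (Subtype.val_injective.mem_set_image).1 (hGU hz)
  · exact ⟨⟨y, Subtype.coe_image_subset I U (hGU hy)⟩, hy⟩

theorem continuity_points_of_quasiContinuous_is_dense_Gδ
    (f : ℝ → ℝ) (hf : QuasiContinuousOn f (Icc 0 1)) :
    ∃ O : ℕ → Set ℝ,
      (∀ n, O n ⊆ Icc 0 1 ∧ IsOpen ((Subtype.val) ⁻¹' (O n) : Set (Icc (0:ℝ) 1)) ∧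
        Dense ((Subtype.val) ⁻¹' (O n) : Set (Icc (0:ℝ) 1))) ∧
      ({x | x ∈ Icc (0:ℝ) 1 ∧ ContinuousWithinAt f (Icc 0 1) x} = ⋂ n, O n) ∧
      Dense ((Subtype.val) ⁻¹'
        {x | x ∈ Icc (0:ℝ) 1 ∧ ContinuousWithinAt f (Icc 0 1) x} : Set (Icc (0:ℝ) 1)) ∧
      {x | x ∈ Icc (0:ℝ) 1 ∧ ContinuousWithinAt f (Icc 0 1) x}.Nonempty := by
  set g : Icc (0:ℝ) 1 → ℝ := (Icc (0:ℝ) 1).domRestrict f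
  have hdense (n : ℕ) : Dense (oscillationLT g (1 / (n + 1))) :=
    dense_oscillationLT (hf.exists_open_dist_lt (half_pos Nat.one_div_pos_of_nat))
  have hpre (S : Set (Icc (0:ℝ) 1)) :
      (Subtype.val ⁻¹' (Subtype.val '' S) : Set (Icc (0:ℝ) 1)) = S :=
    preimage_image_eq _ Subtype.val_injective
  have hC : {x | x ∈ Icc (0:ℝ) 1 ∧ ContinuousWithinAt f (Icc 0 1) x} =
      Subtype.val '' ⋂ n : ℕ, oscillationLT g (1 / (n + 1)) := by
    ext x
    simp only [mem_ofPred_eq, mem_image, mem_iInter, Subtype.exists, exists_and_right,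
      exists_eq_right, ← continuousAt_iff_forall_mem_oscillationLT]
    constructor
    · rintro ⟨hx, h⟩
      exact ⟨hx, (continuousWithinAt_iff_continuousAt_domRestrict f hx).1 h⟩
    · rintro ⟨hx, h⟩
      exact ⟨hx, (continuousWithinAt_iff_continuousAt_domRestrict f hx).2 h⟩
  have hCdense : Dense (⋂ n : ℕ, oscillationLT g (1 / (n + 1))) :=
    dense_iInter_of_isOpen (fun n => isOpen_oscillationLT g _) hdense
  refine ⟨fun n => Subtype.val '' oscillationLT g (1 / (n + 1)), fun n => ?_, ?_, ?_, ?_⟩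
  · rw [hpre]
    exact ⟨Subtype.coe_image_subset _ _, isOpen_oscillationLT g _, hdense n⟩
  · rw [hC, Subtype.val_injective.injOn.image_iInter_eq]
  · rwa [hC, hpre]
  · rw [hC]
    exact hCdense.nonempty.image _
end

section
/- Let f : [0,1] → ℝ be quasi-continuous, x ∈ [0,1], and m, N ∈ ℕ. Then |f(q) − f(r)| ≤ 2^{−m} holds for all rationals q, r ∈ [0,1] with |q − x| < 2^{−N} and |r − x| < 2^{−N} if and only if |f(w) − f(z)| ≤ 2^{−m} holds for all reals w, z ∈ [0,1] with |w − x| < 2^{−N} and |z − x| < 2^{−N} (with the same N on both sides). -/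
open Set

/-- A nonempty relatively open subset of a nondegenerate interval contains a rational. -/
theorem exists_rat_mem_of_isOpen_preimage_Icc {a b : ℝ} (hab : a < b) {G : Set ℝ}
    (hGI : G ⊆ Icc a b) (hne : G.Nonempty)
    (hG : IsOpen (Subtype.val ⁻¹' G : Set (Icc a b))) : ∃ q : ℚ, (q : ℝ) ∈ G := by
  obtain ⟨V, hV, hVG⟩ := isOpen_induced_iff.1 hG
  have mem_iff : ∀ y ∈ Icc a b, y ∈ V ↔ y ∈ G := fun y hy =>
    Set.ext_iff.1 hVG ⟨y, hy⟩
  obtain ⟨g, hg⟩ := hne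
  have hg_closure : g ∈ closure (Ioo a b) := by
    rw [closure_Ioo hab.ne]
    exact hGI hg
  have hne' : (V ∩ Ioo a b).Nonempty :=
    mem_closure_iff.1 hg_closure V hV ((mem_iff g (hGI hg)).2 hg)
  obtain ⟨_, ⟨hqV, hqI⟩, q, rfl⟩ :=
    Rat.denseRange_cast.inter_open_nonempty _ (hV.inter isOpen_Ioo) hne'
  exact ⟨q, (mem_iff _ (Ioo_subset_Icc_self hqI)).1 hqV⟩

/-- Near any point, a quasi-continuous function on a nondegenerate interval is approximated by its
values at rationals. -/
theorem QuasiContinuousOn.exists_rat_abs_sub_lt {f : ℝ → ℝ} {a b : ℝ} (hab : a < b)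
    (hf : QuasiContinuousOn f (Icc a b)) {V : Set ℝ} (hV : IsOpen V) {w : ℝ}
    (hw : w ∈ Icc a b) (hwV : w ∈ V) {ε : ℝ} (hε : 0 < ε) :
    ∃ q : ℚ, (q : ℝ) ∈ Icc a b ∧ (q : ℝ) ∈ V ∧ |f w - f q| < ε := by
  have hU : IsOpen (Subtype.val ⁻¹' (Icc a b ∩ V) : Set (Icc a b)) := by
    rw [Subtype.preimage_coe_self_inter]
    exact hV.preimage continuous_subtype_val
  obtain ⟨G, hGU, hne, hG, hfG⟩ := hf w hw ε hε _ inter_subset_left ⟨hw, hwV⟩ hU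
  obtain ⟨q, hq⟩ :=
    exists_rat_mem_of_isOpen_preimage_Icc hab (hGU.trans inter_subset_left) hne hG
  exact ⟨q, (hGU hq).1, (hGU hq).2, hfG _ hq⟩

theorem rational_oscillation_iff_real_oscillation_of_quasiContinuous
    (f : ℝ → ℝ) (hf : QuasiContinuousOn f (Icc 0 1))
    (x : ℝ) (hx : x ∈ Icc (0:ℝ) 1) (m N : ℕ) :
    (∀ q r : ℚ, (q : ℝ) ∈ Icc (0:ℝ) 1 → (r : ℝ) ∈ Icc (0:ℝ) 1 →
        |(q : ℝ) - x| < 1 / 2 ^ N → |(r : ℝ) - x| < 1 / 2 ^ N →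
        |f q - f r| ≤ 1 / 2 ^ m) ↔
    (∀ w z : ℝ, w ∈ Icc (0:ℝ) 1 → z ∈ Icc (0:ℝ) 1 →
        |w - x| < 1 / 2 ^ N → |z - x| < 1 / 2 ^ N →
        |f w - f z| ≤ 1 / 2 ^ m) := by
  refine ⟨fun h w z hw hz hwx hzx => ?_, fun h q r => h q r⟩
  have hV : IsOpen {y : ℝ | |y - x| < 1 / 2 ^ N} := isOpen_lt (by fun_prop) (by fun_prop)
  refine le_of_forall_pos_lt_add fun ε hε => ?_
  obtain ⟨q, hq, hqx, hqw⟩ := hf.exists_rat_abs_sub_lt zero_lt_one hV hw hwx (half_pos hε)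
  obtain ⟨r, hr, hrx, hrz⟩ := hf.exists_rat_abs_sub_lt zero_lt_one hV hz hzx (half_pos hε)
  have hqr := h q r hq hr hqx hrx
  rw [abs_lt] at hqw hrz ⊢
  rw [abs_le] at hqr
  constructor <;> linarith
end

section
/- Let f : [0,1] → [0,1] be quasi-continuous and Lebesgue integrable on [0,1] with ∫_{[0,1]} f dλ = 0, where λ is Lebesgue measure. Then there exists x ∈ [0,1] with f(x) = 0. -/
open Set MeasureTheory

theorem exists_zero_of_quasiContinuous_integral_zero
    (f : ℝ → ℝ) (hmap : ∀ x ∈ Icc (0:ℝ) 1, f x ∈ Icc (0:ℝ) 1)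
    (hf : QuasiContinuousOn f (Icc 0 1))
    (hint : IntegrableOn f (Icc 0 1) volume)
    (hzero : ∫ x in Icc (0:ℝ) 1, f x ∂volume = 0) :
    ∃ x ∈ Icc (0:ℝ) 1, f x = 0 := by
  have hnonneg : 0 ≤ᵐ[volume.restrict (Icc (0:ℝ) 1)] f :=
    (ae_restrict_mem measurableSet_Icc).mono fun x hx => (hmap x hx).1
  have hae : f =ᵐ[volume.restrict (Icc (0:ℝ) 1)] 0 :=
    (integral_eq_zero_iff_of_nonneg_ae hnonneg hint).1 hzero
  have : (ae (volume.restrict (Icc (0:ℝ) 1))).NeBot :=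
    ae_neBot.2 (by simp only [ne_eq, Measure.restrict_eq_zero, Real.volume_Icc]; norm_num)
  obtain ⟨x, hx, hfx⟩ := ((ae_restrict_mem measurableSet_Icc).and hae).exists
  exact ⟨x, hx, hfx⟩
end

section
/- Let f : [0,1] → ℝ be quasi-continuous and interval integrable on [0,1] with respect to Lebesgue measure, and define F(x) = ∫₀ˣ f(t) dt for x ∈ [0,1]. Then there exists x₀ ∈ (0,1) such that F is differentiable at x₀ with derivative F′(x₀) = f(x₀). -/
open Set MeasureTheory intervalIntegral

theorem exists_deriv_of_quasiContinuous_FTC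
    (f : ℝ → ℝ) (hf : QuasiContinuousOn f (Icc 0 1))
    (hint : IntervalIntegrable f volume 0 1)
    (F : ℝ → ℝ) (hF : ∀ x ∈ Icc (0:ℝ) 1, F x = ∫ t in (0:ℝ)..x, f t) :
    ∃ x₀ ∈ Ioo (0:ℝ) 1, HasDerivAt F (f x₀) x₀ := by
  obtain ⟨x, hx, h⟩ := Measure.exists_mem_of_measure_ne_zero_of_ae
    (s := Ioo (0 : ℝ) 1) (by simp) (ae_restrict_of_ae hint.ae_hasDerivAt_integral)
  rw [uIcc_of_le zero_le_one] at h
  refine ⟨x, hx, (h (Ioo_subset_Icc_self hx) 0 (by simp)).congr_of_eventuallyEq ?_⟩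
  filter_upwards [Icc_mem_nhds hx.1 hx.2] with y hy using hF y hy
end

section
/- Let Ψ : [0,1] → ℝ be quasi-continuous with Ψ(x) > 0 for all x ∈ [0,1]. Then [0,1] ⊆ ⋃_{q ∈ [0,1] ∩ ℚ} (q − Ψ(q), q + Ψ(q)); moreover, there exist finitely many rationals q₀, …, q_k ∈ [0,1] such that [0,1] ⊆ ⋃_{i ≤ k} (q_i − Ψ(q_i), q_i + Ψ(q_i)). -/
open Set

/-- A nonempty relatively open subset of `[0,1]` contains a rational. -/
theorem exists_rat_mem_of_isOpen_Icc {G : Set ℝ} (hGI : G ⊆ Icc (0:ℝ) 1) (hne : G.Nonempty)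
    (hG : IsOpen (Subtype.val ⁻¹' G : Set (Icc (0:ℝ) 1))) : ∃ q : ℚ, (q : ℝ) ∈ G := by
  obtain ⟨V, hV, hVG⟩ := isOpen_induced_iff.mp hG
  have key : ∀ y (hy : y ∈ Icc (0:ℝ) 1), y ∈ V ↔ y ∈ G := fun y hy =>
    Set.ext_iff.mp hVG ⟨y, hy⟩
  obtain ⟨x, hx⟩ := hne
  have hxc : x ∈ closure (Ioo (0:ℝ) 1) := by
    rw [closure_Ioo zero_ne_one]
    exact hGI hx
  obtain ⟨_, hq, q, rfl⟩ := Rat.denseRange_cast.inter_open_nonempty _ (hV.inter isOpen_Ioo)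
    (mem_closure_iff.mp hxc V hV ((key x (hGI hx)).mpr hx))
  exact ⟨q, (key q (Ioo_subset_Icc_self hq.2)).mp hq.1⟩

theorem cousin_quasiContinuous
    (Ψ : ℝ → ℝ) (hΨ : QuasiContinuousOn Ψ (Icc 0 1))
    (hpos : ∀ x ∈ Icc (0:ℝ) 1, Ψ x > 0) :
    (Icc (0:ℝ) 1 ⊆
      ⋃ q ∈ {q : ℚ | (q : ℝ) ∈ Icc (0:ℝ) 1}, Ioo ((q : ℝ) - Ψ q) ((q : ℝ) + Ψ q)) ∧
    ∃ s : Finset ℚ, (∀ q ∈ s, (q : ℝ) ∈ Icc (0:ℝ) 1) ∧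
      Icc (0:ℝ) 1 ⊆ ⋃ q ∈ s, Ioo ((q : ℝ) - Ψ q) ((q : ℝ) + Ψ q) := by
  have cover : Icc (0:ℝ) 1 ⊆
      ⋃ q ∈ {q : ℚ | (q : ℝ) ∈ Icc (0:ℝ) 1}, Ioo ((q : ℝ) - Ψ q) ((q : ℝ) + Ψ q) := by
    intro x hx
    have hε : 0 < Ψ x / 2 := half_pos (hpos x hx)
    obtain ⟨G, hGU, hne, hG, hclose⟩ := hΨ x hx (Ψ x / 2) hε
      (Metric.ball x (Ψ x / 2) ∩ Icc 0 1) inter_subset_right ⟨Metric.mem_ball_self hε, hx⟩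
      (by simpa using Metric.isOpen_ball.preimage continuous_subtype_val)
    obtain ⟨q, hq⟩ := exists_rat_mem_of_isOpen_Icc (hGU.trans inter_subset_right) hne hG
    have hΨq := abs_lt.mp (hclose q hq)
    have hqx := (hGU hq).1
    rw [Metric.mem_ball, Real.dist_eq, abs_lt] at hqx
    exact mem_biUnion (x := q) (hGU hq).2 ⟨by linarith, by linarith⟩
  refine ⟨cover, ?_⟩
  obtain ⟨b, hb, hfin, hcov⟩ :=
    isCompact_Icc.elim_finite_subcover_image (fun _ _ => isOpen_Ioo) cover
  exact ⟨hfin.toFinset, fun q hq => hb (hfin.mem_toFinset.mp hq), by simpa using hcov⟩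
end

section
/- If f : ℝ → ℝ is upper semicontinuous, then the set {x ∈ ℝ : f is continuous at x} is comeager (residual) in ℝ; in particular it is dense in ℝ. -/
theorem UpperSemicontinuous.eventually_residual_continuousAt {X γ : Type*} [TopologicalSpace X]
    [LinearOrder γ] [DenselyOrdered γ] [TopologicalSpace γ] [OrderTopology γ]
    [TopologicalSpace.SeparableSpace γ] {f : X → γ} (hf : UpperSemicontinuous f) :
    ∀ᶠ x in residual X, ContinuousAt f x := by
  obtain ⟨D, hDc, hDd⟩ := TopologicalSpace.exists_countable_dense γ
  have h : ∀ᶠ x in residual X, ∀ q ∈ D, x ∈ coborder (f ⁻¹' Set.Iio q) :=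
    (eventually_countable_ball hDc).2 fun q _ =>
      coborder_mem_residual (hf.isOpen_preimage q).isLocallyClosed
  filter_upwards [h] with x hx
  refine tendsto_order.2 ⟨fun a ha => ?_, hf x⟩
  obtain ⟨q, hqD, haq, hqx⟩ := hDd.exists_between ha
  have hq : x ∉ closure (f ⁻¹' Set.Iio q) := fun hc =>
    hx q hqD ⟨hc, not_lt_of_gt hqx⟩
  filter_upwards [isClosed_closure.isOpen_compl.mem_nhds hq] with y hy
  exact haq.trans_le (not_lt.1 fun hlt => hy (subset_closure hlt))

theorem continuity_points_of_upperSemicontinuous_comeager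
    (f : ℝ → ℝ) (hf : UpperSemicontinuous f) :
    {x : ℝ | ContinuousAt f x} ∈ residual ℝ ∧ Dense {x : ℝ | ContinuousAt f x} :=
  ⟨hf.eventually_residual_continuousAt,
    dense_of_mem_residual hf.eventually_residual_continuousAt⟩
end

section
/- With A, Y and f as above, f is upper semicontinuous on ℝ. -/
open Set

/-- A nonnegative function on a T1 space whose superlevel sets at positive heights are finite
is upper semicontinuous. -/
theorem upperSemicontinuous_of_finite_superlevel {X : Type*} [TopologicalSpace X] [T1Space X]
    {f : X → ℝ} (hf : ∀ x, 0 ≤ f x) (hfin : ∀ y, 0 < y → {z | y ≤ f z}.Finite) :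
    UpperSemicontinuous f := by
  rw [upperSemicontinuous_iff]
  intro x
  rw [upperSemicontinuousAt_iff]
  intro y hy
  have hmem := (hfin y ((hf x).trans_lt hy)).isClosed.isOpen_compl.mem_nhds
    (show x ∈ {z | y ≤ f z}ᶜ from not_le.mpr hy)
  filter_upwards [hmem] with z hz using not_le.mp hz

theorem upperSemicontinuous_of_injective_enumeration
    (A : Set ℝ) (hA : A ⊆ Icc 0 1) (Y : ℝ → ℕ) (hY : Set.InjOn Y A)
    (f : ℝ → ℝ)
    (hf : ∀ x : ℝ, (x ∈ A → f x = 1 / 2 ^ (Y x + 1)) ∧ (x ∉ A → f x = 0)) :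
    UpperSemicontinuous f := by
  refine upperSemicontinuous_of_finite_superlevel (fun x => ?_) (fun y hy => ?_)
  · by_cases hx : x ∈ A
    · rw [(hf x).1 hx]
      positivity
    · rw [(hf x).2 hx]
  · obtain ⟨n, hn⟩ := exists_pow_lt_of_lt_one hy (by norm_num : (1 / 2 : ℝ) < 1)
    have hsub : {z | y ≤ f z} ⊆ A := fun z hz => by
      by_contra hzA
      rw [mem_ofPred_eq, (hf z).2 hzA] at hz
      exact hy.not_ge hz
    refine Finite.of_finite_image ((finite_lt_nat n).subset ?_) (hY.mono hsub)
    rintro _ ⟨z, hz, rfl⟩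
    have hz' : y ≤ (1 / 2 : ℝ) ^ (Y z + 1) := by
      rw [one_div_pow, ← (hf z).1 (hsub hz)]
      exact hz
    have := (pow_lt_pow_iff_right_of_lt_one₀ (by norm_num) (by norm_num)).mp (hn.trans_le hz')
    exact (Nat.lt_succ_self _).trans this
end

section
/- With A, Y and f as above, the variation of f on [0,1] is at most 2: for every finite partition 0 ≤ x₀ < x₁ < ⋯ < x_n ≤ 1 one has ∑_{i<n} |f(x_{i+1}) − f(x_i)| ≤ 2; equivalently eVariationOn f [0,1] ≤ 2, so in particular f has bounded variation on [0,1]. -/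
open Set

theorem sum_le_one_of_injOn_enumeration {α : Type*} {A : Set α} {Y : α → ℕ} (hY : Set.InjOn Y A)
    {f : α → ℝ}
    (hf : ∀ x, (x ∈ A → f x = 1 / 2 ^ (Y x + 1)) ∧ (x ∉ A → f x = 0)) (s : Finset α) :
    ∑ x ∈ s, f x ≤ 1 := by
  classical
  have hsum : HasSum (fun k : ℕ => (1 : ℝ) / 2 / 2 ^ k) 1 := hasSum_geometric_two' 1
  calc ∑ x ∈ s, f x = ∑ x ∈ s with x ∈ A, f x := by
        refine (Finset.sum_filter_of_ne fun x _ hx => ?_).symm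
        by_contra h
        exact hx ((hf x).2 h)
    _ = ∑ x ∈ s with x ∈ A, (1 : ℝ) / 2 / 2 ^ Y x := by
        refine Finset.sum_congr rfl fun x hx => ?_
        rw [(hf x).1 (Finset.mem_filter.1 hx).2, pow_succ', div_div]
    _ = ∑ k ∈ (s.filter (· ∈ A)).image Y, (1 : ℝ) / 2 / 2 ^ k := by
        rw [Finset.sum_image fun x hx y hy h =>
          hY (Finset.mem_filter.1 hx).2 (Finset.mem_filter.1 hy).2 h]
    _ ≤ 1 := sum_le_hasSum _ (fun _ _ => by positivity) hsum

theorem sum_abs_sub_le_two_of_sum_le_one {α : Type*} {f : α → ℝ} (hf : ∀ x, 0 ≤ f x)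
    (hsum : ∀ s : Finset α, ∑ x ∈ s, f x ≤ 1) {n : ℕ} {u : ℕ → α}
    (hu : Set.InjOn u (Set.Iic n)) :
    ∑ i ∈ Finset.range n, |f (u (i + 1)) - f (u i)| ≤ 2 := by
  classical
  have h₁ : ∑ i ∈ Finset.range n, f (u i) ≤ 1 := by
    rw [← Finset.sum_image (f := f) (g := u) (s := Finset.range n) fun i hi j hj h =>
      hu (Finset.mem_range.1 hi).le (Finset.mem_range.1 hj).le h]
    exact hsum _
  have h₂ : ∑ i ∈ Finset.range n, f (u (i + 1)) ≤ 1 := by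
    rw [← Finset.sum_image (f := f) (g := fun i => u (i + 1)) (s := Finset.range n)
      fun i hi j hj h => Nat.succ_injective
        (hu (Nat.succ_le_of_lt (Finset.mem_range.1 hi))
          (Nat.succ_le_of_lt (Finset.mem_range.1 hj)) h)]
    exact hsum _
  calc ∑ i ∈ Finset.range n, |f (u (i + 1)) - f (u i)|
      ≤ ∑ i ∈ Finset.range n, (f (u (i + 1)) + f (u i)) := by
        refine Finset.sum_le_sum fun i _ => ?_
        rw [abs_le]
        constructor <;> linarith [hf (u i), hf (u (i + 1))]
    _ ≤ 2 := by rw [Finset.sum_add_distrib]; linarith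

theorem boundedVariation_of_injective_enumeration
    (A : Set ℝ) (hA : A ⊆ Icc 0 1) (Y : ℝ → ℕ) (hY : Set.InjOn Y A)
    (f : ℝ → ℝ)
    (hf : ∀ x : ℝ, (x ∈ A → f x = 1 / 2 ^ (Y x + 1)) ∧ (x ∉ A → f x = 0)) :
    (∀ (n : ℕ) (u : ℕ → ℝ), (∀ i ≤ n, u i ∈ Icc (0:ℝ) 1) →
      (∀ i < n, u i < u (i + 1)) →
      ∑ i ∈ Finset.range n, |f (u (i + 1)) - f (u i)| ≤ 2) ∧
    eVariationOn f (Icc 0 1) ≤ 2 ∧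
    BoundedVariationOn f (Icc 0 1) := by
  have hf₀ : ∀ x, 0 ≤ f x := fun x => by
    by_cases hx : x ∈ A
    · rw [(hf x).1 hx]; positivity
    · exact ((hf x).2 hx).ge
  have key {n : ℕ} {u : ℕ → ℝ} (hu : StrictMonoOn u (Iic n)) :
      ∑ i ∈ Finset.range n, |f (u (i + 1)) - f (u i)| ≤ 2 :=
    sum_abs_sub_le_two_of_sum_le_one hf₀ (sum_le_one_of_injOn_enumeration hY hf) hu.injOn
  have hvar : eVariationOn f (Icc 0 1) ≤ 2 := by
    rw [eVariationOn.eVariationOn_eq_strictMonoOn]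
    refine iSup_le fun ⟨n, u, hu, _⟩ => ?_
    simp only [edist_dist, Real.dist_eq]
    rw [← ENNReal.ofReal_sum_of_nonneg fun _ _ => abs_nonneg _]
    exact ENNReal.ofReal_le_of_le_toReal (by simpa using key hu)
  refine ⟨fun n u _ hu => key (strictMonoOn_Iic_of_lt_succ hu), hvar, ?_⟩
  exact ne_top_of_le_ne_top ENNReal.ofNat_ne_top hvar
end

section
/- With A, Y and f as above, for every x ∈ ℝ the oscillation of f at x equals f(x); that is, the infimum over open neighbourhoods N of x of the diameter of f(N) (taken in [0,∞], Mathlib's oscillation) equals ENNReal.ofReal (f x). -/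
open Set

open Filter Topology in
/-- A nonnegative function tending to `0` along every punctured neighbourhood is its own
oscillation. -/
theorem oscillation_eq_ofReal_of_tendsto_nhdsNE_zero {f : ℝ → ℝ} {x : ℝ} (hf : ∀ y, 0 ≤ f y)
    (h : Tendsto f (𝓝[≠] x) (𝓝 0)) : oscillation f x = ENNReal.ofReal (f x) := by
  apply le_antisymm
  · refine ENNReal.le_of_forall_pos_le_add fun ε hε _ => ?_
    have hev : ∀ᶠ y in 𝓝 x, f y ∈ Icc 0 (f x + ε) := by
      have hlt : ∀ᶠ y in 𝓝[≠] x, f y < ε := h.eventually_lt_const (NNReal.coe_pos.2 hε)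
      filter_upwards [eventually_nhdsWithin_iff.1 hlt] with y hy
      refine ⟨hf y, ?_⟩
      rcases eq_or_ne y x with rfl | hyx
      · exact le_add_of_nonneg_right ε.2
      · linarith [hy hyx, hf x]
    calc oscillation f x ≤ Metric.ediam (Icc 0 (f x + ε)) := iInf₂_le _ (mem_map.2 hev)
      _ = ENNReal.ofReal (f x) + ε := by
        rw [Real.ediam_Icc, sub_zero, ENNReal.ofReal_add (hf x) ε.coe_nonneg, ENNReal.ofReal_coe_nnreal]
  · refine le_iInf₂ fun S hS => ?_
    have hlim : Tendsto (fun y => edist (f x) (f y)) (𝓝[≠] x) (𝓝 (edist (f x) 0)) :=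
      tendsto_const_nhds.edist h
    have hle : edist (f x) 0 ≤ Metric.ediam S := by
      refine le_of_tendsto hlim ?_
      filter_upwards [nhdsWithin_le_nhds (mem_map.1 hS)] with y hy
      exact Metric.edist_le_ediam_of_mem (mem_of_mem_nhds (mem_map.1 hS) : x ∈ f ⁻¹' S) hy
    rwa [edist_dist, Real.dist_eq, sub_zero, abs_of_nonneg (hf x)] at hle

open Filter Topology in
/-- If `Y` is injective on `A` and `u` tends to `0`, the function equal to `u ∘ Y` on `A` and `0`
elsewhere tends to `0` along the cofinite filter. -/
theorem tendsto_cofinite_zero_of_injOn {α : Type*} {A : Set α} {Y : α → ℕ} (hY : InjOn Y A)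
    {u : ℕ → ℝ} (hu : Tendsto u atTop (𝓝 0)) {f : α → ℝ} (hfA : ∀ x ∈ A, f x = u (Y x))
    (hf0 : ∀ x ∉ A, f x = 0) : Tendsto f cofinite (𝓝 0) := by
  intro s hs
  obtain ⟨N, hN⟩ := mem_atTop_sets.1 (hu hs)
  have hfin : (A ∩ Y ⁻¹' Iio N).Finite :=
    Finite.of_finite_image ((finite_Iio N).subset (image_subset_iff.2 inter_subset_right))
      (hY.mono inter_subset_left)
  refine hfin.subset fun x hx => ?_
  by_cases hxA : x ∈ A
  · refine ⟨hxA, mem_preimage.2 (mem_Iio.2 (not_le.1 fun hle => hx ?_))⟩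
    rw [mem_preimage, hfA x hxA]
    exact hN _ hle
  · refine absurd ?_ hx
    rw [mem_preimage, hf0 x hxA]
    exact mem_of_mem_nhds hs

theorem oscillation_eq_self_of_injective_enumeration
    (A : Set ℝ) (hA : A ⊆ Icc 0 1) (Y : ℝ → ℕ) (hY : Set.InjOn Y A)
    (f : ℝ → ℝ)
    (hf : ∀ x : ℝ, (x ∈ A → f x = 1 / 2 ^ (Y x + 1)) ∧ (x ∉ A → f x = 0)) :
    ∀ x : ℝ, oscillation f x = ENNReal.ofReal (f x) := by
  intro x
  have hnonneg : ∀ y, 0 ≤ f y := fun y => by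
    by_cases hy : y ∈ A
    · rw [(hf y).1 hy]; positivity
    · rw [(hf y).2 hy]
  have hu : Filter.Tendsto (fun n : ℕ => (1 : ℝ) / 2 ^ (n + 1)) Filter.atTop (nhds 0) := by
    simpa only [one_div_pow] using
      (Filter.tendsto_add_atTop_iff_nat 1).2
        (tendsto_pow_atTop_nhds_zero_of_lt_one (r := (1 / 2 : ℝ)) (by norm_num) (by norm_num))
  exact oscillation_eq_ofReal_of_tendsto_nhdsNE_zero hnonneg
    ((tendsto_cofinite_zero_of_injOn hY hu (fun y => (hf y).1) fun y => (hf y).2).mono_left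
      (nhdsNE_le_cofinite x))
end
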